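/- (L^p × L^q → L^{r,∞} paraproduct estimates.) Let 1 < p, q < ∞ and define r by 1/r = 1/p + 1/q (so possibly r < 1). Then ‖π_hl(f,g)‖_{L^{r,∞}} ≤ C(p,q)‖f‖_{L^p}‖g‖_{L^q} for all dyadic test functions f, g ∈ S, where ‖h‖_{L^{r,∞}} := sup_{λ>0} λ·|{x : |h(x)| ≥ λ}|^{1/r} is the weak L^r quasinorm; the same estimate holds for π_lh and π_hh. -/

import Mathlib

open MeasureTheory Set

noncomputable section

namespace Dyadic

/-- A dyadic interval/lacunary tile: `I = [j·2^k, (j+1)·2^k)` with `-M ≤ k ≤ M`,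
`I ⊆ [0, 2^M)`.  Lacunary tiles are in bijection with dyadic intervals, so we
identify the tile `P⁺(I) = I × [1/|I|, 2/|I|)` with the data of `I`. -/
structure Tile (M : ℕ) where
  j : ℤ
  k : ℤ
  hk_lb : -(M : ℤ) ≤ k
  hk_ub : k ≤ (M : ℤ)
  hj : 0 ≤ j
  hsub : ((j : ℝ) + 1) * 2 ^ k ≤ 2 ^ (M : ℤ)

variable {M : ℕ}

/-- The side length `|I_P| = 2^k` of the spatial interval of the tile. -/
def Tile.len (P : Tile M) : ℝ := 2 ^ P.k

/-- The spatial interval `I_P` of the tile. -/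
def Tile.ival (P : Tile M) : Set ℝ :=
  Ico ((P.j : ℝ) * 2 ^ P.k) (((P.j : ℝ) + 1) * 2 ^ P.k)

/-- The order `P ≤′ Q` on lacunary tiles: `I_P ⊆ I_Q`. -/
def Tile.le (P Q : Tile M) : Prop := P.ival ⊆ Q.ival

/-- A (lacunary) tree: a collection of tiles together with a top tile. -/
structure Tree (M : ℕ) where
  tiles : Set (Tile M)
  top : Tile M
  top_mem : top ∈ tiles
  le_top : ∀ P ∈ tiles, P.le top

/-- `|I_T|`, the length of the spatial interval of the top of the tree. -/
def Tree.len (T : Tree M) : ℝ := T.top.len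

/-- A collection of tiles is convex if `P₁ ≤′ P ≤′ P₂` with `P₁, P₂` in the
collection implies `P` is in the collection. -/
def IsConvex (PP : Set (Tile M)) : Prop :=
  ∀ P₁ ∈ PP, ∀ P₂ ∈ PP, ∀ P : Tile M, P₁.le P → P.le P₂ → P ∈ PP

/-- The size `‖a‖_{size(T)} = (1/|I_T|) Σ_{P ∈ T} a(P)` of `a` on a tree `T`. -/
def treeSize (a : Tile M → ℝ) (T : Tree M) : ℝ :=
  (∑ᶠ P ∈ T.tiles, a P) / T.len

/-- The maximal size `‖a‖_{size*(PP)}`: the supremum of `‖a‖_{size(T)}` over all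
convex trees `T ⊆ PP` (by convention `0` if there are none). -/
def maxSize (a : Tile M → ℝ) (PP : Set (Tile M)) : ℝ :=
  sSup (insert 0 {s : ℝ | ∃ T : Tree M, T.tiles ⊆ PP ∧ IsConvex T.tiles ∧ s = treeSize a T})

/-- The complete tree `Tree(P) = {Q : Q ≤′ P}`. -/
def cTree (P : Tile M) : Set (Tile M) := {Q : Tile M | Q.le P}

/-- A tree `T` is complete with respect to `PP` if `T = Tree(P_T) ∩ PP`. -/
def Tree.IsCompleteIn (T : Tree M) (PP : Set (Tile M)) : Prop :=
  T.tiles = cTree T.top ∩ PP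

/-- `QQ` is an `α`-packing of the tree `T`: `QQ ⊆ T` and `Σ_{P ∈ QQ} |I_P| ≤ α|I_T|`. -/
def IsPacking (α : ℝ) (QQ : Set (Tile M)) (T : Tree M) : Prop :=
  QQ ⊆ T.tiles ∧ (∑ᶠ P ∈ QQ, Tile.len P) ≤ α * T.len

/-- `QQ` is a uniform `α`-packing of the tree `T`:
`Σ_{P ∈ QQ, I_P ⊆ J} |I_P| ≤ α|J|` for every dyadic interval `J`. -/
def IsUniformPacking (α : ℝ) (QQ : Set (Tile M)) (T : Tree M) : Prop :=
  QQ ⊆ T.tiles ∧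
    ∀ J : Tile M, (∑ᶠ P ∈ {P ∈ QQ | P.ival ⊆ J.ival}, Tile.len P) ≤ α * J.len

/-- Left half of the spatial interval. -/
def Tile.left (P : Tile M) : Set ℝ :=
  Ico ((P.j : ℝ) * 2 ^ P.k) (((P.j : ℝ) + 1 / 2) * 2 ^ P.k)

/-- Right half of the spatial interval. -/
def Tile.right (P : Tile M) : Set ℝ :=
  Ico (((P.j : ℝ) + 1 / 2) * 2 ^ P.k) (((P.j : ℝ) + 1) * 2 ^ P.k)

/-- The (mother) Haar wavelet `φ_P = |I_P|^{-1/2}(χ_{I_l} - χ_{I_r})`. -/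
def Tile.haar (P : Tile M) : ℝ → ℝ := fun x =>
  (Real.sqrt P.len)⁻¹ * (P.left.indicator 1 x - P.right.indicator 1 x)

/-- The Haar (wavelet) coefficient `Wf(P) = ⟨f, φ_P⟩`. -/
def waveCoeff (f : ℝ → ℝ) (P : Tile M) : ℝ := ∫ x, f x * P.haar x

/-- The average `[f]_{I_P} = (1/|I_P|)∫_{I_P} f`. -/
def tileAvg (f : ℝ → ℝ) (P : Tile M) : ℝ := (∫ x in P.ival, f x) / P.len

/-- The mean `‖f‖_{mean(P)} = (1/|I_P|)∫_{I_P} |f|`. -/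
def tileMean (f : ℝ → ℝ) (P : Tile M) : ℝ := (∫ x in P.ival, |f x|) / P.len

/-- The maximal mean `‖f‖_{mean*(PP)} = sup_{P ∈ PP} ‖f‖_{mean(P)}`. -/
def maxMean (f : ℝ → ℝ) (PP : Set (Tile M)) : ℝ :=
  sSup (insert 0 (tileMean f '' PP))

/-- The dyadic BMO norm `‖f‖_{BMO} = ‖|Wf|²‖_{size*(PP⁺)}^{1/2}`. -/
def bmoNorm (M : ℕ) (f : ℝ → ℝ) : ℝ :=
  Real.sqrt (maxSize (fun P : Tile M => waveCoeff f P ^ 2) univ)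

/-- The grid interval `[j·2^{-M}, (j+1)·2^{-M})` at the finest scale. -/
def gridIval (M : ℕ) (j : ℤ) : Set ℝ :=
  Ico ((j : ℝ) * 2 ^ (-(M : ℤ))) (((j : ℝ) + 1) * 2 ^ (-(M : ℤ)))

/-- A dyadic test function: supported on `[0, 2^M)` and constant on every dyadic
interval of length `2^{-M}`. -/
def IsTestFun (M : ℕ) (f : ℝ → ℝ) : Prop :=
  (∀ x : ℝ, x ∉ Ico (0 : ℝ) (2 ^ (M : ℤ)) → f x = 0) ∧
    ∀ j : ℤ, ∀ x ∈ gridIval M j, ∀ y ∈ gridIval M j, f x = f y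

/-- The `L²` norm. -/
def l2Norm (f : ℝ → ℝ) : ℝ := Real.sqrt (∫ x, f x ^ 2)

/-- The `L^∞` norm (as a supremum of values; adequate for test functions). -/
def supNorm (f : ℝ → ℝ) : ℝ := ⨆ x : ℝ, |f x|

/-- The weak `L^r` quasinorm `sup_{λ>0} λ |{|h| ≥ λ}|^{1/r}`. -/
def weakNorm (r : ℝ) (h : ℝ → ℝ) : ℝ :=
  sSup {s : ℝ | ∃ l : ℝ, 0 < l ∧ s = l * (volume {x : ℝ | l ≤ |h x|}).toReal ^ (1 / r)}

/-- The phase space projection `Π_T f = Σ_{P ∈ T} ⟨f, φ_P⟩ φ_P` onto a tree. -/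
def treeProj (T : Tree M) (f : ℝ → ℝ) : ℝ → ℝ := fun x =>
  ∑ᶠ P ∈ T.tiles, waveCoeff f P * P.haar x

/-- The high-low paraproduct `π_hl(f,g) = Σ_P Wf(P) [g]_P φ_P`. -/
def paraHL (M : ℕ) (f g : ℝ → ℝ) : ℝ → ℝ := fun x =>
  ∑ᶠ P : Tile M, waveCoeff f P * tileAvg g P * P.haar x

/-- The low-high paraproduct `π_lh(f,g) = Σ_P [f]_P Wg(P) φ_P`. -/
def paraLH (M : ℕ) (f g : ℝ → ℝ) : ℝ → ℝ := fun x =>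
  ∑ᶠ P : Tile M, tileAvg f P * waveCoeff g P * P.haar x

/-- The high-high paraproduct `π_hh(f,g) = Σ_P Wf(P) Wg(P) χ_{I_P}/|I_P|`. -/
def paraHH (M : ℕ) (f g : ℝ → ℝ) : ℝ → ℝ := fun x =>
  ∑ᶠ P : Tile M, waveCoeff f P * waveCoeff g P * P.ival.indicator 1 x / P.len

/-- The constant function `1` on `[0, 2^M)`. -/
def oneFn (M : ℕ) : ℝ → ℝ := (Ico (0 : ℝ) (2 ^ (M : ℤ))).indicator 1

/-- A perfect dyadic Calderón–Zygmund operator, recorded via its kernel `K` and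
kernel constant `A₀`. -/
structure PDCZ (M : ℕ) where
  K : ℝ → ℝ → ℝ
  A₀ : ℝ
  hA₀ : 0 < A₀
  meas : Measurable (Function.uncurry K)
  bound : ∀ x y : ℝ, x ≠ y → |K x y| ≤ A₀ / |x - y|
  perfectX : ∀ I J : Tile M, Disjoint I.ival J.ival →
    ∀ x ∈ I.ival, ∀ x' ∈ I.ival, ∀ y ∈ J.ival, K x y = K x' y
  perfectY : ∀ I J : Tile M, Disjoint I.ival J.ival →
    ∀ x ∈ I.ival, ∀ x' ∈ I.ival, ∀ y ∈ J.ival, K y x = K y x'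
  diag : ∀ I : Tile M, I.k = -(M : ℤ) → ∀ x ∈ I.ival, ∀ y ∈ I.ival, K x y = 0
  corner₁ : ∀ x ∈ Ico (0 : ℝ) (2 ^ ((M : ℤ) - 1)),
    ∀ y ∈ Ico ((2 : ℝ) ^ ((M : ℤ) - 1)) (2 ^ (M : ℤ)), K x y = 0
  corner₂ : ∀ x ∈ Ico ((2 : ℝ) ^ ((M : ℤ) - 1)) (2 ^ (M : ℤ)),
    ∀ y ∈ Ico (0 : ℝ) (2 ^ ((M : ℤ) - 1)), K x y = 0

/-- `Tf(x) = ∫ K(x,y) f(y) dy`. -/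
def PDCZ.app (Op : PDCZ M) (f : ℝ → ℝ) : ℝ → ℝ := fun x => ∫ y, Op.K x y * f y

/-- The transpose `T*f(x) = ∫ K(y,x) f(y) dy`. -/
def PDCZ.appT (Op : PDCZ M) (f : ℝ → ℝ) : ℝ → ℝ := fun x => ∫ y, Op.K y x * f y

/-- Complex-valued Haar coefficient. -/
def waveCoeffC (b : ℝ → ℂ) (P : Tile M) : ℂ := ∫ x, b x * (P.haar x : ℂ)

/-- Complex-valued average. -/
def tileAvgC (b : ℝ → ℂ) (P : Tile M) : ℂ := (∫ x in P.ival, b x) / (P.len : ℂ)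

/-- BMO norm of a complex-valued function. -/
def bmoNormC (M : ℕ) (b : ℝ → ℂ) : ℝ :=
  Real.sqrt (maxSize (fun P : Tile M => ‖waveCoeffC b P‖ ^ 2) univ)

/-- Complex-valued dyadic test functions. -/
def IsTestFunC (M : ℕ) (b : ℝ → ℂ) : Prop :=
  (∀ x : ℝ, x ∉ Ico (0 : ℝ) (2 ^ (M : ℤ)) → b x = 0) ∧
    ∀ j : ℤ, ∀ x ∈ gridIval M j, ∀ y ∈ gridIval M j, b x = b y

/-- The operator applied to a complex-valued function. -/
def PDCZ.appC (Op : PDCZ M) (b : ℝ → ℂ) : ℝ → ℂ := fun x => ∫ y, (Op.K x y : ℂ) * b y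


inductive BT where
  | leaf (a b : ℝ) : BT
  | node (l r : BT) : BT

def BT.av (φ : ℝ → ℝ → ℝ) : BT → ℝ
  | .leaf a b => φ a b
  | .node l r => (l.av φ + r.av φ) / 2

def BT.phi (cl cr : BT → BT → ℝ) (t : ℝ) : BT → ℝ → ℝ
  | .leaf _ _, v => if t < |v| then 1 else 0
  | .node l r, v => if t < |v| then 1 else
      (BT.phi cl cr t l (v + cl l r) + BT.phi cl cr t r (v + cr l r)) / 2

def BT.fa : BT → ℝ := BT.av (fun a _ => a)
def BT.ga : BT → ℝ := BT.av (fun _ b => b)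
def BT.F : BT → ℝ := BT.av (fun a _ => |a|)
def BT.G : BT → ℝ := BT.av (fun _ b => |b|)

theorem BT.av_nonneg {φ : ℝ → ℝ → ℝ} (h : ∀ a b, 0 ≤ φ a b) (t : BT) : 0 ≤ t.av φ := by
  induction t with
  | leaf a b => exact h a b
  | node l r hl hr => simp only [BT.av]; linarith

theorem BT.F_nonneg (t : BT) : 0 ≤ t.F := BT.av_nonneg (fun _ _ => abs_nonneg _) t
theorem BT.G_nonneg (t : BT) : 0 ≤ t.G := BT.av_nonneg (fun _ _ => abs_nonneg _) t

theorem BT.fa_le (t : BT) : |t.fa| ≤ t.F := by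
  induction t with
  | leaf a b => exact le_rfl
  | node l r hl hr =>
    simp only [BT.fa, BT.F, BT.av] at *
    rw [abs_le] at *
    constructor <;> linarith [hl.1, hl.2, hr.1, hr.2]

theorem BT.ga_le (t : BT) : |t.ga| ≤ t.G := by
  induction t with
  | leaf a b => exact le_rfl
  | node l r hl hr =>
    simp only [BT.ga, BT.G, BT.av] at *
    rw [abs_le] at *
    constructor <;> linarith [hl.1, hl.2, hr.1, hr.2]

theorem BT.fa_node (l r : BT) : (BT.node l r).fa = (l.fa + r.fa) / 2 := rfl
theorem BT.ga_node (l r : BT) : (BT.node l r).ga = (l.ga + r.ga) / 2 := rfl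
theorem BT.F_node (l r : BT) : (BT.node l r).F = (l.F + r.F) / 2 := rfl
theorem BT.G_node (l r : BT) : (BT.node l r).G = (l.G + r.G) / 2 := rfl

theorem BT.phi_nonneg (cl cr : BT → BT → ℝ) (t : ℝ) (b : BT) (v : ℝ) :
    0 ≤ b.phi cl cr t v := by
  induction b generalizing v with
  | leaf x y => simp only [BT.phi]; split_ifs <;> norm_num
  | node l r hl hr =>
    simp only [BT.phi]; split_ifs
    · norm_num
    · linarith [hl (v + cl l r), hr (v + cr l r)]

theorem BT.phi_le_one (cl cr : BT → BT → ℝ) (t : ℝ) (b : BT) (v : ℝ) :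
    b.phi cl cr t v ≤ 1 := by
  induction b generalizing v with
  | leaf x y => simp only [BT.phi]; split_ifs <;> norm_num
  | node l r hl hr =>
    simp only [BT.phi]; split_ifs
    · norm_num
    · linarith [hl (v + cl l r), hr (v + cr l r)]

theorem BT.phi_eq_one (cl cr : BT → BT → ℝ) (t : ℝ) (b : BT) (v : ℝ) (h : t < |v|) :
    b.phi cl cr t v = 1 := by
  cases b <;> simp [BT.phi, h]

theorem BT.phi_shift (cl cr : BT → BT → ℝ) (t : ℝ) (b : BT) (v u : ℝ) (h : |v - u| ≤ 2 * t) :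
    b.phi cl cr (3 * t) v ≤ b.phi cl cr t u := by
  induction b generalizing v u with
  | leaf x y =>
    simp only [BT.phi]
    have h1 : |v| ≤ |v - u| + |u| := by simpa using abs_add_le (v - u) u
    split_ifs <;> first | (norm_num; done) | (exfalso; linarith)
  | node l r hl hr =>
    have h1 : |v| ≤ |v - u| + |u| := by simpa using abs_add_le (v - u) u
    by_cases hu : t < |u|
    · rw [BT.phi_eq_one _ _ _ _ _ hu]; exact BT.phi_le_one _ _ _ _ _
    · have hv : ¬ 3 * t < |v| := by linarith
      simp only [BT.phi, if_neg hu, if_neg hv]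
      have := hl (v + cl l r) (u + cl l r) (by simpa using h)
      have := hr (v + cr l r) (u + cr l r) (by simpa using h)
      linarith

theorem BT.goodlam (cl cr : BT → BT → ℝ) (t δ e : ℝ) (ht : 0 < t) (hδ : 0 ≤ δ) (he1 : e ≤ t)
    (hcl : ∀ l r, |cl l r| ≤ (BT.node l r).F * (BT.node l r).G)
    (hcr : ∀ l r, |cr l r| ≤ (BT.node l r).F * (BT.node l r).G)
    (hweak : ∀ b : BT, b.F * b.G ≤ e → b.phi cl cr t 0 ≤ δ)
    (φ : ℝ → ℝ → ℝ) (hφ : ∀ a b, 0 ≤ φ a b)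
    (hW : ∀ b : BT, e < b.F * b.G → 1 ≤ b.av φ) (b : BT) (v : ℝ) (hv : |v| ≤ t) :
    b.phi cl cr (3 * t) v ≤ δ * b.phi cl cr t v + b.av φ := by
  induction b generalizing v with
  | leaf x y =>
    have hv3 : ¬ 3 * t < |v| := by linarith
    have h0 := mul_nonneg hδ (BT.phi_nonneg cl cr t (.leaf x y) v)
    have h1 := BT.av_nonneg hφ (.leaf x y)
    have : BT.phi cl cr (3 * t) (.leaf x y) v = 0 := by simp only [BT.phi, if_neg hv3]
    linarith
  | node l r hl hr =>
    have hv3 : ¬ 3 * t < |v| := by linarith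
    have hv1 : ¬ t < |v| := by linarith
    rcases lt_or_ge e ((BT.node l r).F * (BT.node l r).G) with hb | hb
    · have h0 := mul_nonneg hδ (BT.phi_nonneg cl cr t (.node l r) v)
      linarith [hW _ hb, BT.phi_le_one cl cr (3 * t) (.node l r) v]
    · have key : ∀ (b : BT) (c : ℝ), |c| ≤ t →
          (∀ v, |v| ≤ t → b.phi cl cr (3 * t) v ≤ δ * b.phi cl cr t v + b.av φ) →
          b.phi cl cr (3 * t) (v + c) ≤ δ * b.phi cl cr t (v + c) + b.av φ := by
        intro b c hc ih
        by_cases hvc : |v + c| ≤ t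
        · exact ih _ hvc
        · have h2 : |v + c| ≤ 2 * t := (abs_add_le _ _).trans (by linarith)
          rw [BT.phi_eq_one cl cr t b (v + c) (by linarith)]
          rcases lt_or_ge e (b.F * b.G) with hb' | hb'
          · linarith [hW _ hb', BT.phi_le_one cl cr (3 * t) b (v + c)]
          · have := BT.phi_shift cl cr t b (v + c) 0 (by simpa using h2)
            linarith [hweak b hb', BT.av_nonneg hφ b]
      have h1 := key l (cl l r) ((hcl l r).trans (hb.trans he1)) hl
      have h2 := key r (cr l r) ((hcr l r).trans (hb.trans he1)) hr
      simp only [BT.phi, if_neg hv3, if_neg hv1, BT.av]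
      linarith

/-- jumps -/
def BT.jhl (l r : BT) : ℝ := (l.fa - r.fa) / 2 * (BT.node l r).ga
def BT.jhl' (l r : BT) : ℝ := -((l.fa - r.fa) / 2 * (BT.node l r).ga)
def BT.jhh (l r : BT) : ℝ := (l.fa - r.fa) / 2 * ((l.ga - r.ga) / 2)

theorem BT.df_le (l r : BT) : |(l.fa - r.fa) / 2| ≤ (BT.node l r).F := by
  have h1 := abs_le.1 l.fa_le
  have h2 := abs_le.1 r.fa_le
  rw [BT.F_node, abs_le]
  constructor <;> linarith [h1.1, h1.2, h2.1, h2.2]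

theorem BT.dg_le (l r : BT) : |(l.ga - r.ga) / 2| ≤ (BT.node l r).G := by
  have h1 := abs_le.1 l.ga_le
  have h2 := abs_le.1 r.ga_le
  rw [BT.G_node, abs_le]
  constructor <;> linarith [h1.1, h1.2, h2.1, h2.2]

theorem BT.jhl_le (l r : BT) : |BT.jhl l r| ≤ (BT.node l r).F * (BT.node l r).G := by
  rw [BT.jhl, abs_mul]
  exact mul_le_mul (BT.df_le l r) (BT.ga_le _) (abs_nonneg _) (BT.F_nonneg _)

theorem BT.jhl'_le (l r : BT) : |BT.jhl' l r| ≤ (BT.node l r).F * (BT.node l r).G := by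
  rw [BT.jhl', abs_neg]; exact BT.jhl_le l r

theorem BT.jhh_le (l r : BT) : |BT.jhh l r| ≤ (BT.node l r).F * (BT.node l r).G := by
  rw [BT.jhh, abs_mul]
  exact mul_le_mul (BT.df_le l r) (BT.dg_le _ _) (abs_nonneg _) (BT.F_nonneg _)

theorem BT.sq_bound (b : BT) (α : ℝ) (h : b.F ≤ 2 * α) : b.fa ^ 2 ≤ 2 * α * b.F := by
  have h1 : b.fa ^ 2 ≤ b.F ^ 2 := sq_le_sq' (abs_le.1 b.fa_le).1 (abs_le.1 b.fa_le).2
  nlinarith [b.F_nonneg]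

theorem BT.sq_bound_g (b : BT) (α : ℝ) (h : b.G ≤ 2 * α) : b.ga ^ 2 ≤ 2 * α * b.G := by
  have h1 : b.ga ^ 2 ≤ b.G ^ 2 := sq_le_sq' (abs_le.1 b.ga_le).1 (abs_le.1 b.ga_le).2
  nlinarith [b.G_nonneg]

theorem BT.bellman_hl (α β t : ℝ) (hα : 0 < α) (hβ : 0 < β) (ht : 0 < t) (b : BT) (v : ℝ)
    (hF : b.F ≤ 2 * α) :
    b.phi BT.jhl BT.jhl' t v ≤
      b.F / α + b.G / β + (v ^ 2 + β ^ 2 * (2 * α * b.F - b.fa ^ 2)) / t ^ 2 := by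
  induction b generalizing v with
  | leaf x y =>
    have h0 := BT.sq_bound _ _ hF
    have hf := div_nonneg (BT.F_nonneg (.leaf x y)) hα.le
    have hg := div_nonneg (BT.G_nonneg (.leaf x y)) hβ.le
    have he := mul_nonneg (sq_nonneg β) (sub_nonneg.2 h0)
    by_cases hv : t < |v|
    · rw [BT.phi_eq_one _ _ _ _ _ hv]
      have : 1 ≤ (v ^ 2 + β ^ 2 * (2 * α * (BT.leaf x y).F - (BT.leaf x y).fa ^ 2)) / t ^ 2 := by
        rw [one_le_div (by positivity)]
        have : t ^ 2 ≤ v ^ 2 := by rw [← sq_abs v]; gcongr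
        linarith
      linarith
    · simp only [BT.phi, if_neg hv]
      have := div_nonneg (add_nonneg (sq_nonneg v) he) (sq_nonneg t)
      linarith
  | node l r hl hr =>
    have h0 := BT.sq_bound _ _ hF
    have hf := div_nonneg (BT.F_nonneg (.node l r)) hα.le
    have hg := div_nonneg (BT.G_nonneg (.node l r)) hβ.le
    have he := mul_nonneg (sq_nonneg β) (sub_nonneg.2 h0)
    have hE := div_nonneg (add_nonneg (sq_nonneg v) he) (sq_nonneg t)
    have h1 := BT.phi_le_one BT.jhl BT.jhl' t (.node l r) v
    rcases lt_or_ge α (BT.node l r).F with hb | hb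
    · have : 1 ≤ (BT.node l r).F / α := by rw [one_le_div hα]; exact hb.le
      linarith
    rcases lt_or_ge β (BT.node l r).G with hb' | hb'
    · have : 1 ≤ (BT.node l r).G / β := by rw [one_le_div hβ]; exact hb'.le
      linarith
    by_cases hv : t < |v|
    · have : 1 ≤ (v ^ 2 + β ^ 2 * (2 * α * (BT.node l r).F - (BT.node l r).fa ^ 2)) / t ^ 2 := by
        rw [one_le_div (by positivity)]
        have : t ^ 2 ≤ v ^ 2 := by rw [← sq_abs v]; gcongr
        linarith
      linarith
    have hlF := l.F_nonneg
    have hrF := r.F_nonneg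
    have hFn := BT.F_node l r
    have h2 := hl (v + BT.jhl l r) (by linarith)
    have h3 := hr (v + BT.jhl' l r) (by linarith)
    simp only [BT.phi, if_neg hv]
    have hc : BT.jhl l r ^ 2 ≤ ((l.fa - r.fa) / 2) ^ 2 * β ^ 2 := by
      rw [BT.jhl, mul_pow]
      have : (BT.node l r).ga ^ 2 ≤ β ^ 2 := by
        rw [← sq_abs]; have := (BT.ga_le (.node l r)).trans hb'; gcongr
      gcongr
    have hj : BT.jhl' l r = - BT.jhl l r := rfl
    rw [hj] at h3 ⊢
    generalize BT.jhl l r = c at *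
    have hq : ((v + c) ^ 2 + β ^ 2 * (2 * α * l.F - l.fa ^ 2)) / t ^ 2 / 2 +
       ((v + -c) ^ 2 + β ^ 2 * (2 * α * r.F - r.fa ^ 2)) / t ^ 2 / 2 ≤
       (v ^ 2 + β ^ 2 * (2 * α * (BT.node l r).F - (BT.node l r).fa ^ 2)) / t ^ 2 := by
      rw [div_right_comm, div_right_comm _ (t ^ 2), ← add_div]
      apply div_le_div_of_nonneg_right _ (by positivity)
      rw [BT.F_node, BT.fa_node]
      nlinarith
    have hq1 : (BT.node l r).F / α = (l.F / α + r.F / α) / 2 := by rw [BT.F_node]; ring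
    have hq2 : (BT.node l r).G / β = (l.G / β + r.G / β) / 2 := by rw [BT.G_node]; ring
    linarith

theorem BT.bellman_hh (α β t : ℝ) (hα : 0 < α) (hβ : 0 < β) (ht : 0 < t) (b : BT) (v : ℝ)
    (hF : b.F ≤ 2 * α) (hG : b.G ≤ 2 * β) :
    b.phi BT.jhh BT.jhh t v ≤
      b.F / α + b.G / β + (|v| + (β / α * (2 * α * b.F - b.fa ^ 2) +
        α / β * (2 * β * b.G - b.ga ^ 2)) / 2) / t := by
  induction b generalizing v with
  | leaf x y =>
    have h0 := BT.sq_bound _ _ hF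
    have h0' := BT.sq_bound_g _ _ hG
    have hf := div_nonneg (BT.F_nonneg (.leaf x y)) hα.le
    have hg := div_nonneg (BT.G_nonneg (.leaf x y)) hβ.le
    have he := mul_nonneg (div_nonneg hβ.le hα.le) (sub_nonneg.2 h0)
    have he' := mul_nonneg (div_nonneg hα.le hβ.le) (sub_nonneg.2 h0')
    have hv' : |v| / t ≤ (|v| + (β / α * (2 * α * (BT.leaf x y).F - (BT.leaf x y).fa ^ 2) +
        α / β * (2 * β * (BT.leaf x y).G - (BT.leaf x y).ga ^ 2)) / 2) / t := by
      gcongr; linarith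
    by_cases hv : t < |v|
    · rw [BT.phi_eq_one _ _ _ _ _ hv]
      have : 1 ≤ |v| / t := by rw [one_le_div ht]; exact hv.le
      linarith
    · simp only [BT.phi, if_neg hv]
      have := div_nonneg (abs_nonneg v) ht.le
      linarith
  | node l r hl hr =>
    have h0 := BT.sq_bound _ _ hF
    have h0' := BT.sq_bound_g _ _ hG
    have hf := div_nonneg (BT.F_nonneg (.node l r)) hα.le
    have hg := div_nonneg (BT.G_nonneg (.node l r)) hβ.le
    have he := mul_nonneg (div_nonneg hβ.le hα.le) (sub_nonneg.2 h0)
    have he' := mul_nonneg (div_nonneg hα.le hβ.le) (sub_nonneg.2 h0')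
    have hv' : |v| / t ≤ (|v| + (β / α * (2 * α * (BT.node l r).F - (BT.node l r).fa ^ 2) +
        α / β * (2 * β * (BT.node l r).G - (BT.node l r).ga ^ 2)) / 2) / t := by
      gcongr; linarith
    have hv0 := div_nonneg (abs_nonneg v) ht.le
    have h1 := BT.phi_le_one BT.jhh BT.jhh t (.node l r) v
    rcases lt_or_ge α (BT.node l r).F with hb | hb
    · have : 1 ≤ (BT.node l r).F / α := by rw [one_le_div hα]; exact hb.le
      linarith
    rcases lt_or_ge β (BT.node l r).G with hb' | hb'
    · have : 1 ≤ (BT.node l r).G / β := by rw [one_le_div hβ]; exact hb'.le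
      linarith
    by_cases hv : t < |v|
    · have : 1 ≤ |v| / t := by rw [one_le_div ht]; exact hv.le
      linarith
    have hlF := l.F_nonneg
    have hrF := r.F_nonneg
    have hFn := BT.F_node l r
    have hlG := l.G_nonneg
    have hrG := r.G_nonneg
    have hGn := BT.G_node l r
    have h2 := hl (v + BT.jhh l r) (by linarith) (by linarith)
    have h3 := hr (v + BT.jhh l r) (by linarith) (by linarith)
    simp only [BT.phi, if_neg hv]
    have hc : |BT.jhh l r| ≤ (β / α * ((l.fa - r.fa) / 2) ^ 2 +
        α / β * ((l.ga - r.ga) / 2) ^ 2) / 2 := by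
      rw [BT.jhh, abs_mul, ← sq_abs ((l.fa - r.fa) / 2), ← sq_abs ((l.ga - r.ga) / 2)]
      generalize |(l.fa - r.fa) / 2| = x
      generalize |(l.ga - r.ga) / 2| = y
      have : (β / α * x ^ 2 + α / β * y ^ 2) / 2 - x * y = (β * x - α * y) ^ 2 / (2 * α * β) := by
        field_simp; ring
      have : 0 ≤ (β * x - α * y) ^ 2 / (2 * α * β) := by positivity
      linarith
    have hvc := abs_add_le v (BT.jhh l r)
    generalize BT.jhh l r = c at *
    have hq : (|v + c| + (β / α * (2 * α * l.F - l.fa ^ 2) +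
        α / β * (2 * β * l.G - l.ga ^ 2)) / 2) / t / 2 +
       (|v + c| + (β / α * (2 * α * r.F - r.fa ^ 2) +
        α / β * (2 * β * r.G - r.ga ^ 2)) / 2) / t / 2 ≤
       (|v| + (β / α * (2 * α * (BT.node l r).F - (BT.node l r).fa ^ 2) +
        α / β * (2 * β * (BT.node l r).G - (BT.node l r).ga ^ 2)) / 2) / t := by
      rw [div_right_comm, div_right_comm _ t, ← add_div]
      apply div_le_div_of_nonneg_right _ (by positivity)
      rw [BT.F_node, BT.fa_node, BT.G_node, BT.ga_node]
      generalize β / α = x at *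
      generalize α / β = y at *
      nlinarith
    have hq1 : (BT.node l r).F / α = (l.F / α + r.F / α) / 2 := by rw [BT.F_node]; ring
    have hq2 : (BT.node l r).G / β = (l.G / β + r.G / β) / 2 := by rw [BT.G_node]; ring
    linarith

theorem BT.exists_AB (b : BT) (e : ℝ) (he : 0 < e) (h : b.F * b.G ≤ e) :
    ∃ A B : ℝ, 0 < A ∧ 0 < B ∧ b.F ≤ A ∧ b.G ≤ B ∧ A * B = e := by
  rcases eq_or_lt_of_le b.F_nonneg with h0 | h0
  · have hG := b.G_nonneg
    refine ⟨e / (b.G + 1), b.G + 1, by positivity, by positivity, ?_, by linarith, ?_⟩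
    · rw [← h0]; positivity
    · field_simp
  · refine ⟨b.F, e / b.F, h0, by positivity, le_rfl, ?_, ?_⟩
    · rw [le_div_iff₀ h0]; linarith
    · field_simp

theorem BT.weak_hl (t η : ℝ) (ht : 0 < t) (hη : 0 < η) (hη1 : η ≤ 1) (b : BT)
    (h : b.F * b.G ≤ η ^ 2 * t) : b.phi BT.jhl BT.jhl' t 0 ≤ 4 * η := by
  obtain ⟨A, B, hA, hB, hFA, hGB, hAB⟩ := b.exists_AB _ (by positivity) h
  have hF0 := b.F_nonneg
  have hAη : A ≤ A / η := by rw [le_div_iff₀ hη]; nlinarith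
  have := BT.bellman_hl (A / η) (B / η) t (by positivity) (by positivity) ht b 0 (by linarith)
  refine this.trans ?_
  have h1 : b.F / (A / η) ≤ η := by
    rw [div_le_iff₀ (by positivity)]; field_simp; exact hFA
  have h2 : b.G / (B / η) ≤ η := by
    rw [div_le_iff₀ (by positivity)]; field_simp; exact hGB
  have h3 : (0 ^ 2 + (B / η) ^ 2 * (2 * (A / η) * b.F - b.fa ^ 2)) / t ^ 2 ≤ 2 * η := by
    calc _ ≤ (0 ^ 2 + (B / η) ^ 2 * (2 * (A / η) * A)) / t ^ 2 := by
          gcongr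
          have : 2 * (A / η) * b.F ≤ 2 * (A / η) * A := by gcongr
          linarith [sq_nonneg b.fa]
      _ = 2 * (A * B) ^ 2 / (η ^ 3 * t ^ 2) := by field_simp; ring
      _ = 2 * η := by rw [hAB]; field_simp
  linarith

theorem BT.weak_hh (t η : ℝ) (ht : 0 < t) (hη : 0 < η) (hη1 : η ≤ 1) (b : BT)
    (h : b.F * b.G ≤ η ^ 2 * t) : b.phi BT.jhh BT.jhh t 0 ≤ 4 * η := by
  obtain ⟨A, B, hA, hB, hFA, hGB, hAB⟩ := b.exists_AB _ (by positivity) h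
  have hF0 := b.F_nonneg
  have hAη : A ≤ A / η := by rw [le_div_iff₀ hη]; nlinarith
  have hBη : B ≤ B / η := by rw [le_div_iff₀ hη]; nlinarith
  have := BT.bellman_hh (A / η) (B / η) t (by positivity) (by positivity) ht b 0 (by linarith)
    (by linarith)
  refine this.trans ?_
  have h1 : b.F / (A / η) ≤ η := by
    rw [div_le_iff₀ (by positivity)]; field_simp; exact hFA
  have h2 : b.G / (B / η) ≤ η := by
    rw [div_le_iff₀ (by positivity)]; field_simp; exact hGB
  have h3 : (|0| + (B / η / (A / η) * (2 * (A / η) * b.F - b.fa ^ 2) +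
      A / η / (B / η) * (2 * (B / η) * b.G - b.ga ^ 2)) / 2) / t ≤ 2 * η := by
    calc _ ≤ (|0| + (B / η / (A / η) * (2 * (A / η) * A) +
        A / η / (B / η) * (2 * (B / η) * B)) / 2) / t := by
          have : 2 * (A / η) * b.F ≤ 2 * (A / η) * A := by gcongr
          have : 2 * (B / η) * b.G ≤ 2 * (B / η) * B := by gcongr
          gcongr
          · linarith [sq_nonneg b.fa]
          · linarith [sq_nonneg b.ga]
      _ = 2 * (A * B) / (η * t) := by rw [abs_zero]; field_simp; ring
      _ = 2 * η := by rw [hAB]; field_simp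
  linarith

theorem BT.av_lin (φ ψ : ℝ → ℝ → ℝ) (c d : ℝ) (t : BT) :
    t.av (fun a b => c * φ a b + d * ψ a b) = c * t.av φ + d * t.av ψ := by
  induction t with
  | leaf a b => rfl
  | node l r hl hr => simp only [BT.av, hl, hr]; ring

theorem BT.av_jensen (φ : ℝ → ℝ → ℝ) (hφ : ∀ a b, 0 ≤ φ a b) (p : ℝ) (hp : 1 ≤ p) (t : BT) :
    (t.av φ) ^ p ≤ t.av (fun a b => φ a b ^ p) := by
  induction t with
  | leaf a b => exact le_rfl
  | node l r hl hr =>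
    have h := (convexOn_rpow hp).2 (Set.mem_Ici.2 (BT.av_nonneg hφ l))
      (Set.mem_Ici.2 (BT.av_nonneg hφ r)) (by norm_num : (0 : ℝ) ≤ 1 / 2)
      (by norm_num : (0 : ℝ) ≤ 1 / 2) (by norm_num)
    simp only [smul_eq_mul] at h
    simp only [BT.av]
    have e : (l.av φ + r.av φ) / 2 = 1 / 2 * l.av φ + 1 / 2 * r.av φ := by ring
    rw [e]
    linarith

def gcst (r : ℝ) : ℝ := 1 / (8 * 3 ^ r)

theorem BT.iter (cl cr : BT → BT → ℝ) (p q r : ℝ) (hp : 1 < p) (hq : 1 < q)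
    (hr0 : 0 < r) (hr : r / p + r / q = 1)
    (hcl : ∀ l r, |cl l r| ≤ (BT.node l r).F * (BT.node l r).G)
    (hcr : ∀ l r, |cr l r| ≤ (BT.node l r).F * (BT.node l r).G)
    (hweak : ∀ t η : ℝ, 0 < t → 0 < η → η ≤ 1 → ∀ b : BT, b.F * b.G ≤ η ^ 2 * t →
      b.phi cl cr t 0 ≤ 4 * η) (b : BT) (U V : ℝ) (hU : 0 < U) (hV : 0 < V)
    (hbU : b.av (fun x _ => |x| ^ p) ≤ U) (hbV : b.av (fun _ y => |y| ^ q) ≤ V)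
    (t : ℝ) (ht : 0 < t) :
    b.phi cl cr t 0 ≤ 2 * 3 ^ r * ((gcst r ^ 2) ^ r)⁻¹ * (t ^ r)⁻¹ * (U ^ (r / p) * V ^ (r / q)) := by
  have h3 : (1 : ℝ) ≤ 3 ^ r := Real.one_le_rpow (by norm_num) hr0.le
  have hη : 0 < gcst r := by unfold gcst; positivity
  have hη1 : gcst r ≤ 1 := by
    unfold gcst; rw [div_le_one (by positivity)]; linarith
  have hδ : 4 * gcst r * 3 ^ r = 1 / 2 := by unfold gcst; field_simp; norm_num
  have hrp : 0 < r / p := by positivity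
  have hrq : 0 < r / q := by positivity
  generalize gcst r = η at *
  set K := U ^ (r / p) * V ^ (r / q) with hK
  have hKpos : 0 < K := by positivity
  have step : ∀ t : ℝ, 0 < t →
      b.phi cl cr (3 * t) 0 ≤ 4 * η * b.phi cl cr t 0 + K * ((η ^ 2) ^ r)⁻¹ * (t ^ r)⁻¹ := by
    intro t ht
    have he : 0 < η ^ 2 * t := by positivity
    have her : 0 < (η ^ 2 * t) ^ r := by positivity
    have hW : ∀ b : BT, η ^ 2 * t < b.F * b.G → 1 ≤ b.av (fun x y =>
        (K / (η ^ 2 * t) ^ r * (r / p) / U) * |x| ^ p +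
        (K / (η ^ 2 * t) ^ r * (r / q) / V) * |y| ^ q) := by
      intro b hb
      rw [BT.av_lin (fun x _ => |x| ^ p) (fun _ y => |y| ^ q)]
      have j1 : b.F ^ p ≤ b.av (fun x _ => |x| ^ p) :=
        BT.av_jensen (fun a _ => |a|) (fun _ _ => abs_nonneg _) p hp.le b
      have j2 : b.G ^ q ≤ b.av (fun _ y => |y| ^ q) :=
        BT.av_jensen (fun _ a => |a|) (fun _ _ => abs_nonneg _) q hq.le b
      have n1 : 0 ≤ b.av (fun x _ => |x| ^ p) := BT.av_nonneg (fun _ _ => by positivity) b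
      have n2 : 0 ≤ b.av (fun _ y => |y| ^ q) := BT.av_nonneg (fun _ _ => by positivity) b
      generalize b.av (fun x _ => |x| ^ p) = u at *
      generalize b.av (fun _ y => |y| ^ q) = v at *
      have hF := b.F_nonneg
      have hG := b.G_nonneg
      have y1 := Real.geom_mean_le_arith_mean2_weighted hrp.le hrq.le
        (div_nonneg n1 hU.le) (div_nonneg n2 hV.le) hr
      have y2 : (η ^ 2 * t) ^ r ≤ u ^ (r / p) * v ^ (r / q) := by
        calc (η ^ 2 * t) ^ r ≤ (b.F * b.G) ^ r := by gcongr
          _ = (b.F ^ p) ^ (r / p) * (b.G ^ q) ^ (r / q) := by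
            rw [Real.mul_rpow hF hG, ← Real.rpow_mul hF, ← Real.rpow_mul hG]
            congr 2 <;> field_simp
          _ ≤ _ := by gcongr
      rw [Real.div_rpow n1 hU.le, Real.div_rpow n2 hV.le, div_mul_div_comm, ← hK,
        div_le_iff₀ hKpos] at y1
      have : K / (η ^ 2 * t) ^ r * (r / p) / U * u + K / (η ^ 2 * t) ^ r * (r / q) / V * v
        = (r / p * (u / U) + r / q * (v / V)) * K / (η ^ 2 * t) ^ r := by ring
      rw [this, one_le_div her]
      linarith
    have := BT.goodlam cl cr t (4 * η) (η ^ 2 * t) ht (by positivity)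
      (by nlinarith [pow_le_one₀ hη.le hη1 (n := 2)]) hcl hcr
      (fun b hb => hweak t η ht hη hη1 b hb) _ (fun x y => by positivity) hW b 0 (by simpa using ht.le)
    refine this.trans (by
      gcongr
      rw [BT.av_lin (fun x _ => |x| ^ p) (fun _ y => |y| ^ q)]
      calc _ ≤ (K / (η ^ 2 * t) ^ r * (r / p) / U) * U + (K / (η ^ 2 * t) ^ r * (r / q) / V) * V := by
            gcongr
        _ = K / (η ^ 2 * t) ^ r * (r / p + r / q) := by field_simp
        _ = _ := by
          rw [hr, Real.mul_rpow (by positivity) ht.le]; field_simp)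
  have main : ∀ n : ℕ, ∀ t : ℝ, 0 < t → b.phi cl cr t 0 ≤ (4 * η) ^ n +
      2 * 3 ^ r * ((η ^ 2) ^ r)⁻¹ * (t ^ r)⁻¹ * K := by
    intro n
    induction n with
    | zero =>
      intro t ht
      have := BT.phi_le_one cl cr t b 0
      have : 0 ≤ 2 * 3 ^ r * ((η ^ 2) ^ r)⁻¹ * (t ^ r)⁻¹ * K := by positivity
      rw [pow_zero]; linarith
    | succ n ih =>
      intro t ht
      have s1 := step (t / 3) (by positivity)
      have s2 := ih (t / 3) (by positivity)
      rw [mul_div_cancel₀ _ (by norm_num : (3 : ℝ) ≠ 0)] at s1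
      have e : ((t / 3) ^ r)⁻¹ = 3 ^ r * (t ^ r)⁻¹ := by
        rw [Real.div_rpow ht.le (by norm_num), inv_div, div_eq_mul_inv]
      rw [e] at s1 s2
      calc _ ≤ _ := s1
        _ ≤ 4 * η * ((4 * η) ^ n + 2 * 3 ^ r * ((η ^ 2) ^ r)⁻¹ * (3 ^ r * (t ^ r)⁻¹) * K) +
            K * ((η ^ 2) ^ r)⁻¹ * (3 ^ r * (t ^ r)⁻¹) := by gcongr
        _ = (4 * η) ^ (n + 1) + (4 * η * 3 ^ r * 2 + 1) *
              (K * ((η ^ 2) ^ r)⁻¹ * (3 ^ r * (t ^ r)⁻¹)) := by ring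
        _ = _ := by rw [hδ]; ring
  have lim : Filter.Tendsto (fun n : ℕ => (4 * η) ^ n +
      2 * 3 ^ r * ((η ^ 2) ^ r)⁻¹ * (t ^ r)⁻¹ * K) Filter.atTop
      (nhds (0 + 2 * 3 ^ r * ((η ^ 2) ^ r)⁻¹ * (t ^ r)⁻¹ * K)) := by
    apply Filter.Tendsto.add_const
    apply tendsto_pow_atTop_nhds_zero_of_lt_one (by positivity)
    nlinarith
  rw [zero_add] at lim
  exact ge_of_tendsto' lim (fun n => main n t ht)

theorem BT.final (cl cr : BT → BT → ℝ) (p q r : ℝ) (hp : 1 < p) (hq : 1 < q)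
    (hr0 : 0 < r) (hr : r / p + r / q = 1)
    (hcl : ∀ l r, |cl l r| ≤ (BT.node l r).F * (BT.node l r).G)
    (hcr : ∀ l r, |cr l r| ≤ (BT.node l r).F * (BT.node l r).G)
    (hweak : ∀ t η : ℝ, 0 < t → 0 < η → η ≤ 1 → ∀ b : BT, b.F * b.G ≤ η ^ 2 * t →
      b.phi cl cr t 0 ≤ 4 * η) (b : BT) (t : ℝ) (ht : 0 < t) :
    b.phi cl cr t 0 ≤ 2 * 3 ^ r * ((gcst r ^ 2) ^ r)⁻¹ * (t ^ r)⁻¹ *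
      ((b.av (fun x _ => |x| ^ p)) ^ (r / p) * (b.av (fun _ y => |y| ^ q)) ^ (r / q)) := by
  have n1 : 0 ≤ b.av (fun x _ => |x| ^ p) := BT.av_nonneg (fun _ _ => by positivity) b
  have n2 : 0 ≤ b.av (fun _ y => |y| ^ q) := BT.av_nonneg (fun _ _ => by positivity) b
  have key : ∀ s : ℝ, 0 < s → b.phi cl cr t 0 ≤ 2 * 3 ^ r * ((gcst r ^ 2) ^ r)⁻¹ * (t ^ r)⁻¹ *
      ((b.av (fun x _ => |x| ^ p) + s) ^ (r / p) * (b.av (fun _ y => |y| ^ q) + s) ^ (r / q)) :=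
    fun s hs => BT.iter cl cr p q r hp hq hr0 hr hcl hcr hweak b _ _ (by positivity) (by positivity)
      (by linarith) (by linarith) t ht
  have hc : Continuous (fun s : ℝ => 2 * 3 ^ r * ((gcst r ^ 2) ^ r)⁻¹ * (t ^ r)⁻¹ *
      ((b.av (fun x _ => |x| ^ p) + s) ^ (r / p) * (b.av (fun _ y => |y| ^ q) + s) ^ (r / q))) := by
    apply Continuous.mul continuous_const
    apply Continuous.mul
    · exact (continuous_const.add continuous_id).rpow_const (fun _ => Or.inr (by positivity))
    · exact (continuous_const.add continuous_id).rpow_const (fun _ => Or.inr (by positivity))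
  have lim := (hc.tendsto 0).mono_left (nhdsWithin_le_nhds (s := Ioi 0))
  simp only [add_zero] at lim
  exact ge_of_tendsto lim (by filter_upwards [self_mem_nhdsWithin] with s hs using key s hs)

/-- grid level interval -/
def ivl (M n j : ℕ) : Set ℝ :=
  Ico ((j : ℝ) * 2 ^ ((n : ℤ) - M)) (((j : ℝ) + 1) * 2 ^ ((n : ℤ) - M))

def tr (M : ℕ) (f g : ℝ → ℝ) : ℕ → ℕ → BT
  | 0, j => .leaf (f ((j : ℝ) * 2 ^ (-(M : ℤ)))) (g ((j : ℝ) * 2 ^ (-(M : ℤ))))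
  | n + 1, j => .node (tr M f g n (2 * j)) (tr M f g n (2 * j + 1))

theorem zpow_step (M n : ℕ) : (2 : ℝ) ^ (((n + 1 : ℕ) : ℤ) - M) = 2 * 2 ^ ((n : ℤ) - M) := by
  rw [show (((n + 1 : ℕ) : ℤ) - M) = ((n : ℤ) - M) + 1 by push_cast; ring,
    zpow_add_one₀ (by norm_num)]
  ring

theorem ivl_left (M n j : ℕ) : ivl M n (2 * j) =
    Ico ((j : ℝ) * 2 ^ (((n + 1 : ℕ) : ℤ) - M)) (((j : ℝ) + 1 / 2) * 2 ^ (((n + 1 : ℕ) : ℤ) - M)) := by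
  rw [ivl, zpow_step]; push_cast; congr 1 <;> ring

theorem ivl_right (M n j : ℕ) : ivl M n (2 * j + 1) =
    Ico (((j : ℝ) + 1 / 2) * 2 ^ (((n + 1 : ℕ) : ℤ) - M))
      (((j : ℝ) + 1) * 2 ^ (((n + 1 : ℕ) : ℤ) - M)) := by
  rw [ivl, zpow_step]; push_cast; congr 1 <;> ring

theorem ivl_union (M n j : ℕ) : ivl M (n + 1) j = ivl M n (2 * j) ∪ ivl M n (2 * j + 1) := by
  rw [ivl_left, ivl_right, ivl, Ico_union_Ico_eq_Ico]
  · gcongr; linarith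
  · gcongr; norm_num

theorem ivl_disj (M n j : ℕ) : Disjoint (ivl M n (2 * j)) (ivl M n (2 * j + 1)) := by
  rw [ivl_left, ivl_right]
  rw [Set.disjoint_left]
  intro x hx hx'
  exact absurd hx.2 (not_lt.2 hx'.1)

theorem volume_ivl (M n j : ℕ) : volume (ivl M n j) = ENNReal.ofReal (2 ^ ((n : ℤ) - M)) := by
  rw [ivl, Real.volume_Ico]; congr 1; ring

theorem tr_integral (M : ℕ) (f g : ℝ → ℝ) (hf : IsTestFun M f) (hg : IsTestFun M g)
    (φ : ℝ → ℝ → ℝ) (n j : ℕ) :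
    IntegrableOn (fun x => φ (f x) (g x)) (ivl M n j) ∧
    ∫ x in ivl M n j, φ (f x) (g x) = 2 ^ ((n : ℤ) - M) * (tr M f g n j).av φ := by
  induction n generalizing j with
  | zero =>
    have hmem : ((j : ℝ) * 2 ^ (-(M : ℤ))) ∈ gridIval M j := by
      simp only [gridIval]; push_cast
      constructor
      · exact le_rfl
      · gcongr; linarith
    have hE : ∀ x ∈ ivl M 0 j, φ (f x) (g x) =
        φ (f ((j : ℝ) * 2 ^ (-(M : ℤ)))) (g ((j : ℝ) * 2 ^ (-(M : ℤ)))) := by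
      intro x hx
      have hx' : x ∈ gridIval M j := by
        simpa [ivl, gridIval] using hx
      rw [hf.2 j x hx' _ hmem, hg.2 j x hx' _ hmem]
    have hm : MeasurableSet (ivl M 0 j) := measurableSet_Ico
    constructor
    · rw [integrableOn_congr_fun hE hm]
      apply integrableOn_const
      · rw [volume_ivl]; exact ENNReal.ofReal_ne_top
      · simp
    · rw [setIntegral_congr_fun hm hE, setIntegral_const, Measure.real, volume_ivl,
        ENNReal.toReal_ofReal (by positivity)]
      rfl
  | succ n ih =>
    obtain ⟨a1, a2⟩ := ih (2 * j)
    obtain ⟨b1, b2⟩ := ih (2 * j + 1)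
    rw [ivl_union]
    refine ⟨a1.union b1, ?_⟩
    rw [setIntegral_union (ivl_disj M n j) measurableSet_Ico a1 b1, a2, b2, zpow_step]
    simp only [tr, BT.av]
    ring

theorem Tile.ext' {M : ℕ} {P Q : Tile M} (hj : P.j = Q.j) (hk : P.k = Q.k) : P = Q := by
  cases P; cases Q; simp only at hj hk; subst hj; subst hk; rfl

instance tileFinite (M : ℕ) : Finite (Tile M) := by
  let φ : Tile M → Icc (0 : ℤ) (2 ^ (2 * M)) × Icc (-(M : ℤ)) M := fun P =>
    (⟨P.j, P.hj, by
      have h := P.hsub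
      have h1 : (2 : ℝ) ^ (-(M : ℤ)) ≤ 2 ^ P.k := zpow_le_zpow_right₀ (by norm_num) P.hk_lb
      have hj : (0 : ℝ) ≤ P.j := by exact_mod_cast P.hj
      have h2 : (P.j : ℝ) * 2 ^ (-(M : ℤ)) ≤ 2 ^ (M : ℤ) := by
        refine le_trans ?_ h
        gcongr; linarith
      rw [zpow_neg, ← div_eq_mul_inv, div_le_iff₀ (by positivity)] at h2
      have : (P.j : ℝ) ≤ ((2 ^ (2 * M) : ℤ) : ℝ) := by
        push_cast; rw [two_mul, pow_add]; exact_mod_cast h2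
      exact_mod_cast this⟩, ⟨P.k, P.hk_lb, P.hk_ub⟩)
  apply Finite.of_injective φ
  intro P Q h
  simp only [φ, Prod.mk.injEq] at h
  exact Tile.ext' (congrArg Subtype.val h.1) (congrArg Subtype.val h.2)

theorem mem_ivl_unique {x a : ℝ} (ha : 0 < a) {i j : ℤ}
    (hi : x ∈ Ico ((i : ℝ) * a) (((i : ℝ) + 1) * a))
    (hj : x ∈ Ico ((j : ℝ) * a) (((j : ℝ) + 1) * a)) : i = j := by
  have h1 : (i : ℝ) < j + 1 := lt_of_mul_lt_mul_right (hi.1.trans_lt hj.2) ha.le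
  have h2 : (j : ℝ) < i + 1 := lt_of_mul_lt_mul_right (hj.1.trans_lt hi.2) ha.le
  have h1' : i < j + 1 := by exact_mod_cast h1
  have h2' : j < i + 1 := by exact_mod_cast h2
  omega

def hpart (M : ℕ) [Fintype (Tile M)] (T : Tile M → ℝ → ℝ) (n : ℕ) (x : ℝ) : ℝ :=
  ∑ P : Tile M, if P.k ≤ (n : ℤ) - M then T P x else 0

theorem hpart_succ (M : ℕ) [Fintype (Tile M)] (T : Tile M → ℝ → ℝ)
    (hsupp : ∀ P x, x ∉ P.ival → T P x = 0) (n : ℕ) (x : ℝ) (Q : Tile M)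
    (hQ : Q.k = ((n + 1 : ℕ) : ℤ) - M) (hx : x ∈ Q.ival) :
    hpart M T (n + 1) x = T Q x + hpart M T n x := by
  have h1 : T Q x = ∑ P : Tile M, if P.k = ((n + 1 : ℕ) : ℤ) - M then T P x else 0 := by
    rw [Finset.sum_eq_single Q]
    · rw [if_pos hQ]
    · intro P _ hPQ
      split_ifs with hP
      · apply hsupp
        intro hxP
        apply hPQ
        have hk : P.k = Q.k := hP.trans hQ.symm
        refine Tile.ext' ?_ hk
        unfold Tile.ival at hxP hx
        rw [hk] at hxP
        exact mem_ivl_unique (by positivity) hxP hx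
      · rfl
    · simp
  rw [h1, hpart, hpart, ← Finset.sum_add_distrib]
  apply Finset.sum_congr rfl
  intro P _
  push_cast
  split_ifs <;> first | omega | simp

theorem transfer_aux (M : ℕ) [Fintype (Tile M)] (f g : ℝ → ℝ) (T : Tile M → ℝ → ℝ)
    (cl cr : BT → BT → ℝ)
    (hsupp : ∀ P x, x ∉ P.ival → T P x = 0)
    (h0 : ∀ P x, P.k = -(M : ℤ) → T P x = 0)
    (hl : ∀ (P : Tile M) (n j : ℕ), P.k = ((n + 1 : ℕ) : ℤ) - M → P.j = j → ∀ x ∈ ivl M n (2 * j),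
      T P x = cl (tr M f g n (2 * j)) (tr M f g n (2 * j + 1)))
    (hr : ∀ (P : Tile M) (n j : ℕ), P.k = ((n + 1 : ℕ) : ℤ) - M → P.j = j →
      ∀ x ∈ ivl M n (2 * j + 1),
      T P x = cr (tr M f g n (2 * j)) (tr M f g n (2 * j + 1)))
    (t : ℝ) (n : ℕ) (hn : n ≤ 2 * M) (j : ℕ)
    (hj : ((j : ℝ) + 1) * 2 ^ ((n : ℤ) - M) ≤ 2 ^ (M : ℤ)) (v : ℝ) :
    volume {x | x ∈ ivl M n j ∧ t < |v + hpart M T n x|} ≤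
      ENNReal.ofReal (2 ^ ((n : ℤ) - M) * (tr M f g n j).phi cl cr t v) := by
  have triv : ∀ n j (s : Set ℝ), t < |v| → volume {x | x ∈ ivl M n j ∧ x ∈ s} ≤
      ENNReal.ofReal (2 ^ ((n : ℤ) - M) * (tr M f g n j).phi cl cr t v) := by
    intro n j s hv
    rw [BT.phi_eq_one _ _ _ _ _ hv, _root_.mul_one, ← volume_ivl M n j]
    exact measure_mono (fun x hx => hx.1)
  induction n generalizing j v with
  | zero =>
    by_cases hv : t < |v|
    · exact triv _ _ {x | t < |v + hpart M T 0 x|} hv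
    · have : {x | x ∈ ivl M 0 j ∧ t < |v + hpart M T 0 x|} = ∅ := by
        rw [Set.eq_empty_iff_forall_notMem]
        rintro x ⟨_, hx⟩
        have : hpart M T 0 x = 0 := by
          apply Finset.sum_eq_zero
          intro P _
          split_ifs with hP
          · have := P.hk_lb
            apply h0; push_cast at hP; omega
          · rfl
        rw [this, _root_.add_zero] at hx
        exact hv hx
      rw [this]; simp
  | succ n ih =>
    by_cases hv : t < |v|
    · exact triv _ _ {x | t < |v + hpart M T (n + 1) x|} hv
    · let Q : Tile M := ⟨j, ((n + 1 : ℕ) : ℤ) - M, by push_cast; omega, by push_cast; omega,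
        by positivity, by exact_mod_cast hj⟩
      have hQi : Q.ival = ivl M (n + 1) j := by simp [Tile.ival, ivl, Q]
      have hz := zpow_step M n
      have hz0 : (0 : ℝ) < 2 ^ ((n : ℤ) - M) := by positivity
      have triv' : ∀ v n j (s : Set ℝ), t < |v| → volume {x | x ∈ ivl M n j ∧ x ∈ s} ≤
          ENNReal.ofReal (2 ^ ((n : ℤ) - M) * (tr M f g n j).phi cl cr t v) := by
        intro v n j s hv
        rw [BT.phi_eq_one _ _ _ _ _ hv, _root_.mul_one, ← volume_ivl M n j]
        exact measure_mono (fun x hx => hx.1)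
      have i1 := ih (by omega) (2 * j) (by push_cast; rw [hz] at hj; nlinarith)
        (v + cl (tr M f g n (2 * j)) (tr M f g n (2 * j + 1))) (triv' _)
      have i2 := ih (by omega) (2 * j + 1) (by push_cast; rw [hz] at hj; nlinarith)
        (v + cr (tr M f g n (2 * j)) (tr M f g n (2 * j + 1))) (triv' _)
      have e : (2 : ℝ) ^ (((n + 1 : ℕ) : ℤ) - M) * (tr M f g (n + 1) j).phi cl cr t v =
        2 ^ ((n : ℤ) - M) * (tr M f g n (2 * j)).phi cl cr t
          (v + cl (tr M f g n (2 * j)) (tr M f g n (2 * j + 1))) +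
        2 ^ ((n : ℤ) - M) * (tr M f g n (2 * j + 1)).phi cl cr t
          (v + cr (tr M f g n (2 * j)) (tr M f g n (2 * j + 1))) := by
        rw [hz]; simp only [tr, BT.phi, if_neg hv]; ring
      rw [e, ENNReal.ofReal_add (mul_nonneg hz0.le (BT.phi_nonneg _ _ _ _ _))
        (mul_nonneg hz0.le (BT.phi_nonneg _ _ _ _ _))]
      refine le_trans ?_ (add_le_add i1 i2)
      refine le_trans (measure_mono ?_) (measure_union_le _ _)
      rintro x ⟨hx, hx'⟩
      rw [hpart_succ M T hsupp n x Q rfl (hQi ▸ hx), ← _root_.add_assoc] at hx'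
      rw [ivl_union] at hx
      rcases hx with hx | hx
      · left; exact ⟨hx, by rwa [hl Q n j rfl rfl x hx] at hx'⟩
      · right; exact ⟨hx, by rwa [hr Q n j rfl rfl x hx] at hx'⟩

theorem tile_ival_subset {M : ℕ} (P : Tile M) : P.ival ⊆ ivl M (2 * M) 0 := by
  intro x hx
  have hj : (0 : ℝ) ≤ P.j := by exact_mod_cast P.hj
  have e : (((2 * M : ℕ) : ℤ) - M) = M := by push_cast; ring
  simp only [ivl]
  rw [e]
  refine ⟨?_, ?_⟩
  · simp only [Nat.cast_zero, zero_mul]; exact le_trans (by positivity) hx.1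
  · simp only [Nat.cast_zero, _root_.zero_add, _root_.one_mul]; exact hx.2.trans_le P.hsub

theorem transfer (M : ℕ) (f g : ℝ → ℝ) (T : Tile M → ℝ → ℝ)
    (cl cr : BT → BT → ℝ)
    (hsupp : ∀ P x, x ∉ P.ival → T P x = 0)
    (h0 : ∀ P x, P.k = -(M : ℤ) → T P x = 0)
    (hl : ∀ (P : Tile M) (n j : ℕ), P.k = ((n + 1 : ℕ) : ℤ) - M → P.j = j → ∀ x ∈ ivl M n (2 * j),
      T P x = cl (tr M f g n (2 * j)) (tr M f g n (2 * j + 1)))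
    (hr : ∀ (P : Tile M) (n j : ℕ), P.k = ((n + 1 : ℕ) : ℤ) - M → P.j = j →
      ∀ x ∈ ivl M n (2 * j + 1),
      T P x = cr (tr M f g n (2 * j)) (tr M f g n (2 * j + 1)))
    (t : ℝ) (ht : 0 < t) :
    (volume {x | t ≤ |∑ᶠ P : Tile M, T P x|}).toReal ≤
      2 ^ (M : ℤ) * (tr M f g (2 * M) 0).phi cl cr (t / 2) 0 := by
  have : Fintype (Tile M) := Fintype.ofFinite _
  have e : (((2 * M : ℕ) : ℤ) - M) = M := by push_cast; ring
  have h := transfer_aux M f g T cl cr hsupp h0 hl hr (t / 2) (2 * M) le_rfl 0 (by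
    rw [e]; simp) 0
  rw [e] at h
  apply ENNReal.toReal_le_of_le_ofReal (mul_nonneg (by positivity) (BT.phi_nonneg _ _ _ _ _))
  refine le_trans (measure_mono ?_) h
  intro x hx
  simp only [mem_ofPred_eq] at hx ⊢
  rw [finsum_eq_sum_of_fintype] at hx
  constructor
  · by_contra hx'
    have : ∑ P : Tile M, T P x = 0 := Finset.sum_eq_zero fun P _ =>
      hsupp P x (fun hP => hx' (tile_ival_subset P hP))
    rw [this, abs_zero] at hx
    linarith
  · have : hpart M T (2 * M) x = ∑ P : Tile M, T P x := by
      apply Finset.sum_congr rfl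
      intro P _
      rw [if_pos]; rw [e]; exact P.hk_ub
    rw [this, _root_.zero_add]; linarith

theorem Tile.len_pos {M : ℕ} (P : Tile M) : 0 < P.len := by unfold Tile.len; positivity

theorem haar_supp {M : ℕ} (P : Tile M) (x : ℝ) (hx : x ∉ P.ival) : P.haar x = 0 := by
  have hp : (0 : ℝ) < 2 ^ P.k := by positivity
  have h1 : x ∉ P.left := fun h => hx ⟨h.1, h.2.trans (by gcongr; norm_num)⟩
  have h2 : x ∉ P.right := fun h => hx ⟨le_trans (by gcongr; linarith) h.1, h.2⟩
  simp [Tile.haar, h1, h2]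

theorem haar_left {M : ℕ} (P : Tile M) (x : ℝ) (hx : x ∈ P.left) :
    P.haar x = (Real.sqrt P.len)⁻¹ := by
  have h2 : x ∉ P.right := fun h => absurd hx.2 (not_lt.2 h.1)
  simp [Tile.haar, hx, h2]

theorem haar_right {M : ℕ} (P : Tile M) (x : ℝ) (hx : x ∈ P.right) :
    P.haar x = -(Real.sqrt P.len)⁻¹ := by
  have h2 : x ∉ P.left := fun h => absurd h.2 (not_lt.2 hx.1)
  simp [Tile.haar, hx, h2]

theorem waveCoeff_eq {M : ℕ} (f : ℝ → ℝ) (P : Tile M) (h1 : IntegrableOn f P.left)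
    (h2 : IntegrableOn f P.right) :
    waveCoeff f P = (Real.sqrt P.len)⁻¹ * ((∫ x in P.left, f x) - ∫ x in P.right, f x) := by
  have hl : MeasurableSet P.left := measurableSet_Ico
  have hr : MeasurableSet P.right := measurableSet_Ico
  have e : (fun x => f x * P.haar x) = fun x => (Real.sqrt P.len)⁻¹ *
      (P.left.indicator f x - P.right.indicator f x) := by
    funext x
    by_cases h1 : x ∈ P.left <;> by_cases h2 : x ∈ P.right <;>
      simp [Tile.haar, h1, h2, _root_.mul_comm]
  rw [waveCoeff, e, integral_const_mul, integral_sub, integral_indicator hl, integral_indicator hr]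
  · exact h1.integrable_indicator hl
  · exact h2.integrable_indicator hr

theorem tile_left {M : ℕ} (P : Tile M) (n j : ℕ) (hk : P.k = ((n + 1 : ℕ) : ℤ) - M)
    (hj : P.j = j) : P.left = ivl M n (2 * j) := by
  rw [ivl_left, Tile.left, hk, hj]; rfl

theorem tile_right {M : ℕ} (P : Tile M) (n j : ℕ) (hk : P.k = ((n + 1 : ℕ) : ℤ) - M)
    (hj : P.j = j) : P.right = ivl M n (2 * j + 1) := by
  rw [ivl_right, Tile.right, hk, hj]; rfl

theorem tile_ival {M : ℕ} (P : Tile M) (n j : ℕ) (hk : P.k = (n : ℤ) - M)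
    (hj : P.j = j) : P.ival = ivl M n j := by
  rw [ivl, Tile.ival, hk, hj]; rfl

theorem wave_zero {M : ℕ} (f : ℝ → ℝ) (hf : IsTestFun M f) (P : Tile M) (hk : P.k = -(M : ℤ)) :
    waveCoeff f P = 0 := by
  have hp : (0 : ℝ) < 2 ^ P.k := by positivity
  set a := f ((P.j : ℝ) * 2 ^ P.k) with ha
  have hval : ∀ x ∈ P.ival, f x = a := by
    intro x hx
    apply hf.2 P.j x
    · simpa [gridIval, Tile.ival, hk] using hx
    · rw [gridIval, ← hk]
      exact ⟨le_rfl, by gcongr; linarith⟩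
  have e1 : ∀ x ∈ P.left, f x = a :=
    fun x h => hval x ⟨h.1, h.2.trans (by gcongr; norm_num)⟩
  have e2 : ∀ x ∈ P.right, f x = a :=
    fun x h => hval x ⟨le_trans (by gcongr; linarith) h.1, h.2⟩
  have hl : MeasurableSet P.left := measurableSet_Ico
  have hr : MeasurableSet P.right := measurableSet_Ico
  rw [waveCoeff_eq]
  · rw [setIntegral_congr_fun hl e1, setIntegral_congr_fun hr e2, setIntegral_const,
      setIntegral_const, Measure.real, Measure.real, Tile.left, Tile.right, Real.volume_Ico,
      Real.volume_Ico]
    ring_nf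
  · rw [integrableOn_congr_fun e1 hl]
    exact integrableOn_const (by rw [Tile.left, Real.volume_Ico]; exact ENNReal.ofReal_ne_top) (by simp)
  · rw [integrableOn_congr_fun e2 hr]
    exact integrableOn_const (by rw [Tile.right, Real.volume_Ico]; exact ENNReal.ofReal_ne_top) (by simp)

theorem wave_f {M : ℕ} (f g : ℝ → ℝ) (hf : IsTestFun M f) (hg : IsTestFun M g) (P : Tile M)
    (n j : ℕ) (hk : P.k = ((n + 1 : ℕ) : ℤ) - M) (hj : P.j = j) :
    waveCoeff f P = Real.sqrt P.len * (((tr M f g n (2 * j)).fa - (tr M f g n (2 * j + 1)).fa) / 2) := by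
  obtain ⟨a1, a2⟩ := tr_integral M f g hf hg (fun a _ => a) n (2 * j)
  obtain ⟨b1, b2⟩ := tr_integral M f g hf hg (fun a _ => a) n (2 * j + 1)
  rw [← tile_left P n j hk hj] at a1 a2
  rw [← tile_right P n j hk hj] at b1 b2
  have hs : 0 < Real.sqrt P.len := Real.sqrt_pos.2 P.len_pos
  have hlen : Real.sqrt P.len * Real.sqrt P.len = 2 * 2 ^ ((n : ℤ) - M) := by
    rw [Real.mul_self_sqrt P.len_pos.le, Tile.len, hk, zpow_step]
  rw [waveCoeff_eq f P a1 b1, a2, b2]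
  simp only [BT.fa]
  rw [inv_mul_eq_iff_eq_mul₀ hs.ne']
  linear_combination (-1 / 2 : ℝ) * ((tr M f g n (2 * j)).av (fun a _ => a) -
    (tr M f g n (2 * j + 1)).av (fun a _ => a)) * hlen

theorem wave_g {M : ℕ} (f g : ℝ → ℝ) (hf : IsTestFun M f) (hg : IsTestFun M g) (P : Tile M)
    (n j : ℕ) (hk : P.k = ((n + 1 : ℕ) : ℤ) - M) (hj : P.j = j) :
    waveCoeff g P = Real.sqrt P.len * (((tr M f g n (2 * j)).ga - (tr M f g n (2 * j + 1)).ga) / 2) := by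
  obtain ⟨a1, a2⟩ := tr_integral M f g hf hg (fun _ a => a) n (2 * j)
  obtain ⟨b1, b2⟩ := tr_integral M f g hf hg (fun _ a => a) n (2 * j + 1)
  rw [← tile_left P n j hk hj] at a1 a2
  rw [← tile_right P n j hk hj] at b1 b2
  have hs : 0 < Real.sqrt P.len := Real.sqrt_pos.2 P.len_pos
  have hlen : Real.sqrt P.len * Real.sqrt P.len = 2 * 2 ^ ((n : ℤ) - M) := by
    rw [Real.mul_self_sqrt P.len_pos.le, Tile.len, hk, zpow_step]
  rw [waveCoeff_eq g P a1 b1, a2, b2]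
  simp only [BT.ga]
  rw [inv_mul_eq_iff_eq_mul₀ hs.ne']
  linear_combination (-1 / 2 : ℝ) * ((tr M f g n (2 * j)).av (fun _ a => a) -
    (tr M f g n (2 * j + 1)).av (fun _ a => a)) * hlen

theorem avg_g {M : ℕ} (f g : ℝ → ℝ) (hf : IsTestFun M f) (hg : IsTestFun M g) (P : Tile M)
    (n j : ℕ) (hk : P.k = (n : ℤ) - M) (hj : P.j = j) :
    tileAvg g P = (tr M f g n j).ga := by
  obtain ⟨a1, a2⟩ := tr_integral M f g hf hg (fun _ a => a) n j
  rw [tileAvg, tile_ival P n j hk hj, a2, ← hk, Tile.len, BT.ga]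
  field_simp

theorem full_integral (M : ℕ) (f g : ℝ → ℝ) (hf : IsTestFun M f) (hg : IsTestFun M g)
    (φ : ℝ → ℝ → ℝ) (h0 : ∀ x, x ∉ Ico (0 : ℝ) (2 ^ (M : ℤ)) → φ (f x) (g x) = 0) :
    ∫ x, φ (f x) (g x) = 2 ^ (M : ℤ) * (tr M f g (2 * M) 0).av φ := by
  have e : (((2 * M : ℕ) : ℤ) - M) = M := by push_cast; ring
  have h := (tr_integral M f g hf hg φ (2 * M) 0).2
  rw [e] at h
  rw [← h]
  symm
  apply setIntegral_eq_integral_of_forall_compl_eq_zero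
  intro x hx
  apply h0
  intro hx'
  apply hx
  rw [ivl, e]
  simpa using hx'

def fcst (r : ℝ) : ℝ := 2 * (2 * 3 ^ r * ((gcst r ^ 2) ^ r)⁻¹) ^ (1 / r)

theorem fcst_pos (r : ℝ) : 0 < fcst r := by
  have : 0 < gcst r := by unfold gcst; positivity
  unfold fcst; positivity

theorem weak_final (p q r : ℝ) (hp : 1 < p) (hq : 1 < q) (hr0 : 0 < r) (hr : r / p + r / q = 1)
    (M : ℕ) (f g : ℝ → ℝ) (hf : IsTestFun M f) (hg : IsTestFun M g)
    (T : Tile M → ℝ → ℝ)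
    (cl cr : BT → BT → ℝ)
    (hcl : ∀ l r, |cl l r| ≤ (BT.node l r).F * (BT.node l r).G)
    (hcr : ∀ l r, |cr l r| ≤ (BT.node l r).F * (BT.node l r).G)
    (hweak : ∀ t η : ℝ, 0 < t → 0 < η → η ≤ 1 → ∀ b : BT, b.F * b.G ≤ η ^ 2 * t →
      b.phi cl cr t 0 ≤ 4 * η)
    (hsupp : ∀ P x, x ∉ P.ival → T P x = 0)
    (h0 : ∀ P x, P.k = -(M : ℤ) → T P x = 0)
    (hl : ∀ (P : Tile M) (n j : ℕ), P.k = ((n + 1 : ℕ) : ℤ) - M → P.j = j → ∀ x ∈ ivl M n (2 * j),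
      T P x = cl (tr M f g n (2 * j)) (tr M f g n (2 * j + 1)))
    (hrr : ∀ (P : Tile M) (n j : ℕ), P.k = ((n + 1 : ℕ) : ℤ) - M → P.j = j →
      ∀ x ∈ ivl M n (2 * j + 1),
      T P x = cr (tr M f g n (2 * j)) (tr M f g n (2 * j + 1))) :
    weakNorm r (fun x => ∑ᶠ P : Tile M, T P x) ≤
      fcst r * (∫ x, |f x| ^ p) ^ (1 / p) * (∫ x, |g x| ^ q) ^ (1 / q) := by
  have hη : 0 < gcst r := by unfold gcst; positivity
  have hC := fcst_pos r
  have hp0 : 0 < p := by linarith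
  have hq0 : 0 < q := by linarith
  have i1 : 0 ≤ ∫ x, |f x| ^ p := integral_nonneg (fun x => by positivity)
  have i2 : 0 ≤ ∫ x, |g x| ^ q := integral_nonneg (fun x => by positivity)
  apply Real.sSup_le _ (by positivity)
  rintro s ⟨t, ht, rfl⟩
  have h1 := transfer M f g T cl cr hsupp h0 hl hrr t ht
  have h2 := BT.final cl cr p q r hp hq hr0 hr hcl hcr hweak (tr M f g (2 * M) 0) (t / 2) (by positivity)
  have I1 := full_integral M f g hf hg (fun x _ => |x| ^ p) (fun x hx => by
    simp only [hf.1 x hx, abs_zero, Real.zero_rpow hp0.ne'])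
  have I2 := full_integral M f g hf hg (fun _ x => |x| ^ q) (fun x hx => by
    simp only [hg.1 x hx, abs_zero, Real.zero_rpow hq0.ne'])
  rw [I1, I2]
  have n1 : 0 ≤ (tr M f g (2 * M) 0).av (fun x _ => |x| ^ p) :=
    BT.av_nonneg (fun _ _ => by positivity) _
  have n2 : 0 ≤ (tr M f g (2 * M) 0).av (fun _ y => |y| ^ q) :=
    BT.av_nonneg (fun _ _ => by positivity) _
  generalize (tr M f g (2 * M) 0).av (fun x _ => |x| ^ p) = u at *
  generalize (tr M f g (2 * M) 0).av (fun _ y => |y| ^ q) = v at *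
  generalize (tr M f g (2 * M) 0).phi cl cr (t / 2) 0 = z at *
  have hN : (0 : ℝ) < 2 ^ (M : ℤ) := by positivity
  generalize (2 : ℝ) ^ (M : ℤ) = N at *
  have hfc : fcst r = 2 * (2 * 3 ^ r * ((gcst r ^ 2) ^ r)⁻¹) ^ (1 / r) := rfl
  generalize gcst r = η at *
  have h3 : (volume {x | t ≤ |∑ᶠ P : Tile M, T P x|}).toReal ≤
      (2 * 3 ^ r * ((η ^ 2) ^ r)⁻¹) * ((t / 2) ^ r)⁻¹ * ((N * u) ^ (r / p) * (N * v) ^ (r / q)) := by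
    refine h1.trans ((mul_le_mul_of_nonneg_left h2 hN.le).trans (le_of_eq ?_))
    rw [Real.mul_rpow hN.le n1, Real.mul_rpow hN.le n2]
    have : N = N ^ (r / p) * N ^ (r / q) := by
      rw [← Real.rpow_add hN, hr, Real.rpow_one]
    nth_rewrite 1 [this]
    ring
  have hrinv : 0 ≤ 1 / r := by positivity
  calc t * (volume {x | t ≤ |∑ᶠ P : Tile M, T P x|}).toReal ^ (1 / r)
      ≤ t * ((2 * 3 ^ r * ((η ^ 2) ^ r)⁻¹) * ((t / 2) ^ r)⁻¹ *
        ((N * u) ^ (r / p) * (N * v) ^ (r / q))) ^ (1 / r) := by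
        gcongr
    _ = _ := by
      rw [Real.mul_rpow (by positivity) (by positivity), Real.mul_rpow (by positivity) (by positivity),
        Real.mul_rpow (x := (N * u) ^ (r / p)) (by positivity) (by positivity),
        ← Real.rpow_mul (by positivity) (r / p), ← Real.rpow_mul (by positivity) (r / q),
        Real.inv_rpow (by positivity), ← Real.rpow_mul (by positivity) r,
        mul_one_div_cancel hr0.ne', Real.rpow_one, hfc,
        show r / p * (1 / r) = 1 / p by field_simp, show r / q * (1 / r) = 1 / q by field_simp]
      field_simp

theorem hl_final (p q r : ℝ) (hp : 1 < p) (hq : 1 < q) (hr0 : 0 < r) (hr : r / p + r / q = 1)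
    (M : ℕ) (f g : ℝ → ℝ) (hf : IsTestFun M f) (hg : IsTestFun M g) :
    weakNorm r (paraHL M f g) ≤
      fcst r * (∫ x, |f x| ^ p) ^ (1 / p) * (∫ x, |g x| ^ q) ^ (1 / q) := by
  refine weak_final p q r hp hq hr0 hr M f g hf hg
    (fun P x => waveCoeff f P * tileAvg g P * P.haar x) BT.jhl BT.jhl' BT.jhl_le BT.jhl'_le
    BT.weak_hl ?_ ?_ ?_ ?_
  · intro P x hx
    simp only [haar_supp P x hx, MulZeroClass.mul_zero]
  · intro P x hk
    simp only [wave_zero f hf P hk, MulZeroClass.zero_mul]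
  · intro P n j hk hj x hx
    have hs : 0 < Real.sqrt P.len := Real.sqrt_pos.2 P.len_pos
    rw [haar_left P x (by rwa [tile_left P n j hk hj]), wave_f f g hf hg P n j hk hj,
      avg_g f g hf hg P (n + 1) j hk hj, BT.jhl, tr]
    field_simp
  · intro P n j hk hj x hx
    have hs : 0 < Real.sqrt P.len := Real.sqrt_pos.2 P.len_pos
    rw [haar_right P x (by rwa [tile_right P n j hk hj]), wave_f f g hf hg P n j hk hj,
      avg_g f g hf hg P (n + 1) j hk hj, BT.jhl', tr]
    field_simp

theorem hh_final (p q r : ℝ) (hp : 1 < p) (hq : 1 < q) (hr0 : 0 < r) (hr : r / p + r / q = 1)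
    (M : ℕ) (f g : ℝ → ℝ) (hf : IsTestFun M f) (hg : IsTestFun M g) :
    weakNorm r (paraHH M f g) ≤
      fcst r * (∫ x, |f x| ^ p) ^ (1 / p) * (∫ x, |g x| ^ q) ^ (1 / q) := by
  have key : ∀ (P : Tile M) (n j : ℕ), P.k = ((n + 1 : ℕ) : ℤ) - M → P.j = j →
      ∀ x ∈ ivl M (n + 1) j, waveCoeff f P * waveCoeff g P * P.ival.indicator 1 x / P.len =
        BT.jhh (tr M f g n (2 * j)) (tr M f g n (2 * j + 1)) := by
    intro P n j hk hj x hx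
    have hs : Real.sqrt P.len * Real.sqrt P.len = P.len := Real.mul_self_sqrt P.len_pos.le
    have hlen := P.len_pos
    rw [Set.indicator_of_mem (by rwa [tile_ival P (n + 1) j hk hj]), wave_f f g hf hg P n j hk hj,
      wave_g f g hf hg P n j hk hj, BT.jhh, div_eq_iff hlen.ne', Pi.one_apply]
    linear_combination (((tr M f g n (2 * j)).fa - (tr M f g n (2 * j + 1)).fa) / 2) *
      (((tr M f g n (2 * j)).ga - (tr M f g n (2 * j + 1)).ga) / 2) * hs
  refine weak_final p q r hp hq hr0 hr M f g hf hg
    (fun P x => waveCoeff f P * waveCoeff g P * P.ival.indicator 1 x / P.len) BT.jhh BT.jhh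
    BT.jhh_le BT.jhh_le BT.weak_hh ?_ ?_ ?_ ?_
  · intro P x hx
    simp only [Set.indicator_of_notMem hx, MulZeroClass.mul_zero, zero_div]
  · intro P x hk
    simp only [wave_zero f hf P hk, MulZeroClass.zero_mul, zero_div]
  · intro P n j hk hj x hx
    exact key P n j hk hj x (by rw [ivl_union]; exact Or.inl hx)
  · intro P n j hk hj x hx
    exact key P n j hk hj x (by rw [ivl_union]; exact Or.inr hx)

/-- Proposition 6.5: `L^p × L^q → L^{r,∞}` paraproduct estimates. -/
theorem statement13 (p q r : ℝ) (hp : 1 < p) (hq : 1 < q)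
    (hr : 1 / r = 1 / p + 1 / q) :
    ∃ C : ℝ, 0 < C ∧
      ∀ (M : ℕ) (f g : ℝ → ℝ), IsTestFun M f → IsTestFun M g →
        weakNorm r (paraHL M f g) ≤
          C * (∫ x, |f x| ^ p) ^ (1 / p) * (∫ x, |g x| ^ q) ^ (1 / q) ∧
        weakNorm r (paraLH M f g) ≤
          C * (∫ x, |f x| ^ p) ^ (1 / p) * (∫ x, |g x| ^ q) ^ (1 / q) ∧
        weakNorm r (paraHH M f g) ≤
          C * (∫ x, |f x| ^ p) ^ (1 / p) * (∫ x, |g x| ^ q) ^ (1 / q) := by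
  have hp0 : 0 < p := by linarith
  have hq0 : 0 < q := by linarith
  have hr0 : 0 < r := by
    have : 0 < 1 / r := by rw [hr]; positivity
    exact one_div_pos.1 this
  have hr1 : r / p + r / q = 1 := by
    have : r * (1 / r) = 1 := mul_one_div_cancel hr0.ne'
    rw [hr] at this
    rw [← this]; ring
  refine ⟨fcst r, fcst_pos r, fun M f g hf hg => ⟨hl_final p q r hp hq hr0 hr1 M f g hf hg, ?_,
    hh_final p q r hp hq hr0 hr1 M f g hf hg⟩⟩
  have h := hl_final q p r hq hp hr0 (by linarith) M g f hg hf
  have e : paraLH M f g = paraHL M g f := by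
    funext x
    simp only [paraLH, paraHL]
    congr 1
    funext P
    ring
  rw [e]
  refine h.trans (le_of_eq ?_)
  ring

end Dyadic
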